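/- arXiv:2210.10503 — 3 statements merged into one kernel-verified Lean document; each statement's English description precedes it below -/
import Mathlib

section
/- Let ℓ ≥ 1 and h ≥ 1 be integers, let a_1, …, a_ℓ be positive integers, and let G be the complete multipartite graph with parts I_1, …, I_ℓ of sizes |I_j| = a_j. Then the minimum, over all h-colourings c of G, of the number of monochromatic edges of c equals the minimum, over all partitions of {1,…,ℓ} into h (possibly empty) sets A_1, …, A_h, of (1/2)·( Σ_{i=1}^{h} ( Σ_{j∈A_i} a_j )² − Σ_{j=1}^{ℓ} a_j² ). -/
variable {V : Type*}

/-- The number of monochromatic edges of the (not necessarily proper) colouring `c`. -/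
noncomputable def monoCount {α : Type*} (G : SimpleGraph V) (c : V → α) : ℕ :=
  {e ∈ G.edgeSet | ∃ u v : V, e = s(u, v) ∧ c u = c v}.ncard

open Finset in
/-- Twice the number of monochromatic edges counts the ordered monochromatic adjacent pairs. -/
theorem two_mul_monoCount {α : Type*} [Fintype V] [DecidableEq α]
    (G : SimpleGraph V) [DecidableRel G.Adj] (c : V → α) :
    2 * monoCount G c = ∑ u, ∑ v, if G.Adj u v ∧ c u = c v then 1 else 0 := by
  classical
  let H : SimpleGraph V :=
    { Adj := fun u v => G.Adj u v ∧ c u = c v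
      symm := ⟨fun _ _ huv => ⟨huv.1.symm, huv.2.symm⟩⟩
      loopless := ⟨fun _ hu => G.loopless.irrefl _ hu.1⟩ }
  have hset : {e ∈ G.edgeSet | ∃ u v : V, e = s(u, v) ∧ c u = c v} = H.edgeSet := by
    ext e
    induction e using Sym2.ind with
    | _ x y =>
      simp only [Set.mem_ofPred_eq, SimpleGraph.mem_edgeSet, H]
      refine and_congr_right fun _ => ⟨?_, fun hxy => ⟨x, y, rfl, hxy⟩⟩
      rintro ⟨u, v, huv, hc⟩
      rcases Sym2.eq_iff.1 huv with ⟨rfl, rfl⟩ | ⟨rfl, rfl⟩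
      · exact hc
      · exact hc.symm
  rw [monoCount, hset, ← SimpleGraph.coe_edgeFinset, Set.ncard_coe_finset,
    ← SimpleGraph.sum_degrees_eq_twice_card_edges]
  refine sum_congr rfl fun u _ => ?_
  rw [← SimpleGraph.card_neighborFinset_eq_degree, SimpleGraph.neighborFinset_eq_filter,
    card_filter]

open Finset in
/-- The ordered monochromatic pairs of a complete multipartite graph, grouped by pairs of parts. -/
theorem two_mul_monoCount_completeMultipartiteGraph {ι α : Type*} [Fintype ι] [DecidableEq ι]
    [DecidableEq α] {β : ι → Type*} [∀ j, Fintype (β j)] (c : (Σ j, β j) → α) :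
    2 * monoCount (SimpleGraph.completeMultipartiteGraph β) c =
      ∑ j, ∑ k, if j ≠ k then ∑ x, ∑ y, if c ⟨j, x⟩ = c ⟨k, y⟩ then 1 else 0 else 0 := by
  classical
  rw [two_mul_monoCount, Fintype.sum_sigma]
  refine sum_congr rfl fun j _ => ?_
  simp_rw [Fintype.sum_sigma]
  rw [sum_comm]
  refine sum_congr rfl fun k _ => ?_
  by_cases hjk : j = k <;> simp [hjk]

open Finset in
/-- Averaging a function of two distinct coordinates over a product type. -/
theorem sum_pi_sum_sum_eq {ι : Type*} [Fintype ι] [DecidableEq ι]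
    {β : ι → Type*} [∀ j, Fintype (β j)] {j k : ι} (hjk : j ≠ k) (g : β j → β k → ℕ) :
    ∑ f : ∀ i, β i, ∑ _x : β j, ∑ _y : β k, g (f j) (f k) =
      ∑ _f : ∀ i, β i, ∑ x : β j, ∑ y : β k, g x y := by
  let σ : (∀ i, β i) × β j × β k → (∀ i, β i) × β j × β k :=
    fun p => (Function.update (Function.update p.1 j p.2.1) k p.2.2, p.1 j, p.1 k)
  have hσ : Function.Involutive σ := by
    rintro ⟨f, x, y⟩
    refine Prod.ext ?_ (Prod.ext ?_ ?_)
    · funext i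
      by_cases hk : i = k
      · subst hk; simp [σ]
      · by_cases hj : i = j
        · subst hj; simp [σ, hk]
        · simp [σ, hk, hj]
    · simp [σ, hjk]
    · simp [σ]
  have hsum := Equiv.sum_comp hσ.toPerm fun p => g p.2.1 p.2.2
  simpa only [Fintype.sum_prod_type, Function.Involutive.coe_toPerm, σ] using hsum

open Finset in
/-- Some colouring that is constant on the parts has at most as many monochromatic edges as `c`. -/
theorem exists_monoCount_comp_fst_le {ι α : Type*} [Fintype ι] [DecidableEq ι]
    {β : ι → Type*} [∀ j, Fintype (β j)] [∀ j, Nonempty (β j)] (c : (Σ j, β j) → α) :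
    ∃ P : ι → α, monoCount (SimpleGraph.completeMultipartiteGraph β) (fun u => P u.1) ≤
      monoCount (SimpleGraph.completeMultipartiteGraph β) c := by
  classical
  have key : ∑ f : ∀ i, β i, 2 * monoCount (SimpleGraph.completeMultipartiteGraph β)
        (fun u => c ⟨u.1, f u.1⟩) =
      ∑ _f : ∀ i, β i, 2 * monoCount (SimpleGraph.completeMultipartiteGraph β) c := by
    simp_rw [two_mul_monoCount_completeMultipartiteGraph]
    rw [sum_comm, sum_comm (s := univ (α := ∀ i, β i))]
    refine sum_congr rfl fun j _ => ?_
    rw [sum_comm, sum_comm (s := univ (α := ∀ i, β i))]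
    refine sum_congr rfl fun k _ => ?_
    by_cases hjk : j = k
    · simp [hjk]
    · simp only [ne_eq, hjk, not_false_eq_true, if_true]
      exact sum_pi_sum_sum_eq hjk fun x y => if c ⟨j, x⟩ = c ⟨k, y⟩ then 1 else 0
  obtain ⟨f, -, hf⟩ := exists_le_of_sum_le univ_nonempty key.le
  exact ⟨fun j => c ⟨j, f j⟩, by simpa using hf⟩

open Finset in
/-- The number of monochromatic edges of a colouring that is constant on the parts. -/
theorem monoCount_comp_fst {ι α : Type*} [Fintype ι] [DecidableEq ι] [Fintype α] [DecidableEq α]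
    (a : ι → ℕ) (P : ι → α) :
    monoCount (SimpleGraph.completeMultipartiteGraph fun j => Fin (a j)) (fun u => P u.1) =
      ((∑ i, (∑ j ∈ univ.filter fun j => P j = i, a j) ^ 2) - ∑ j, a j ^ 2) / 2 := by
  have hsq : ∑ i, (∑ j ∈ univ.filter fun j => P j = i, a j) ^ 2 =
      ∑ j, ∑ k, if P j = P k then a j * a k else 0 := by
    simp_rw [sq, sum_mul_sum, sum_filter]
    rw [sum_comm]
    refine sum_congr rfl fun j _ => ?_
    simp [eq_comm]
  have hsplit : ∑ j, ∑ k, (if P j = P k then a j * a k else 0) =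
      2 * monoCount (SimpleGraph.completeMultipartiteGraph fun j => Fin (a j))
        (fun u => P u.1) + ∑ j, a j ^ 2 := by
    rw [two_mul_monoCount_completeMultipartiteGraph, ← sum_add_distrib]
    refine sum_congr rfl fun j _ => ?_
    have hdiag : a j ^ 2 = ∑ k, if j = k then a j * a k else 0 := by simp [sq]
    rw [hdiag, ← sum_add_distrib]
    refine sum_congr rfl fun k _ => ?_
    by_cases hjk : j = k
    · simp [hjk]
    · by_cases hP : P j = P k <;> simp [hjk, hP]
  rw [hsq, hsplit]
  omega

/-- For the complete multipartite graph with parts of sizes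
`a 1, …, a ℓ`, the minimum number of monochromatic edges over all `h`-colourings equals
the minimum over all partitions of the index set into `h` (possibly empty) parts `A i`
of `(1/2)·(Σ_i (Σ_{j ∈ A i} a j)² − Σ_j (a j)²)`. -/
theorem stmt13 (ℓ h : ℕ) (hℓ : 1 ≤ ℓ) (hh : 1 ≤ h)
    (a : Fin ℓ → ℕ) (ha : ∀ j, 1 ≤ a j) :
    sInf {m | ∃ c : (Σ j : Fin ℓ, Fin (a j)) → Fin h,
        monoCount (SimpleGraph.completeMultipartiteGraph fun j : Fin ℓ => Fin (a j)) c = m}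
      =
    sInf {m | ∃ P : Fin ℓ → Fin h,
        m = ((∑ i : Fin h,
            (∑ j ∈ Finset.univ.filter fun j => P j = i, a j) ^ 2) -
          ∑ j : Fin ℓ, a j ^ 2) / 2} := by
  have : ∀ j, Nonempty (Fin (a j)) := fun j => ⟨⟨0, ha j⟩⟩
  simp_rw [← monoCount_comp_fst]
  apply le_antisymm
  · obtain ⟨P, hP⟩ := Nat.sInf_mem (s := {m | ∃ P : Fin ℓ → Fin h,
        m = monoCount (SimpleGraph.completeMultipartiteGraph fun j : Fin ℓ => Fin (a j))
          (fun u => P u.1)}) ⟨_, fun _ => ⟨0, hh⟩, rfl⟩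
    exact Nat.sInf_le ⟨fun u => P u.1, hP.symm⟩
  · obtain ⟨c, hc⟩ := Nat.sInf_mem (s := {m | ∃ c : (Σ j : Fin ℓ, Fin (a j)) → Fin h,
        monoCount (SimpleGraph.completeMultipartiteGraph fun j : Fin ℓ => Fin (a j)) c = m})
        ⟨_, fun _ => ⟨0, hh⟩, rfl⟩
    obtain ⟨P, hP⟩ := exists_monoCount_comp_fst_le c
    rw [← hc]
    exact le_trans (Nat.sInf_le ⟨P, rfl⟩) hP
end

section
/- Let X be a finite set of variables, C a finite set of clauses each consisting of two distinct variables from X, and k ≥ 1 an integer. Let G be the graph with vertex set {v_x : x ∈ X} ∪ (⋃_{x∈X} K_x) ∪ {v_c : c ∈ C}, where the sets K_x have size 2k+1 each and all listed sets are pairwise disjoint, and with edges so that: each K_x is a clique and v_x is adjacent to all of K_x; the set K_C = {v_c : c ∈ C} is a clique; and for each clause c = (x ∨ y) ∈ C, the vertex v_c is adjacent to all of K_x and all of K_y. Then G is chordal, i.e., G has no induced cycle of length at least four. -/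
variable {V : Type*}

/-- A graph is chordal if it has no induced cycle on four or more vertices. -/
def IsChordal (G : SimpleGraph V) : Prop :=
  ∀ n, 4 ≤ n → ¬ ∃ f : Fin n ↪ V, ∀ i j,
    (SimpleGraph.cycleGraph n).Adj i j ↔ G.Adj (f i) (f j)

/-- The gadget graph built from a variable set `X`, a clause set `C` (each clause an
unordered pair of variables) and an integer `k`. Its vertices are the variable vertices
`v_x` (left summand), the clique vertices `K_x = {x} × Fin (2k+1)` (middle summand) and
the clause vertices `v_c` (right summand). Each `K_x` is a clique, `v_x` is complete to
`K_x`, the clause vertices form a clique `K_C`, and for a clause `c` containing the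
variable `y`, the vertex `v_c` is complete to `K_y`. -/
def gadget (X : Type*) (C : Finset (Sym2 X)) (k : ℕ) :
    SimpleGraph (X ⊕ (X × Fin (2 * k + 1)) ⊕ {e : Sym2 X // e ∈ C}) :=
  SimpleGraph.fromRel fun u v =>
    match u, v with
    | Sum.inl x, Sum.inr (Sum.inl (y, _)) => x = y
    | Sum.inr (Sum.inl (x, _)), Sum.inr (Sum.inl (y, _)) => x = y
    | Sum.inr (Sum.inr _), Sum.inr (Sum.inr _) => True
    | Sum.inr (Sum.inr c), Sum.inr (Sum.inl (y, _)) => y ∈ c.1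
    | _, _ => False

/-- Every vertex of a cycle of length at least four has two distinct nonadjacent neighbours. -/
theorem exists_nonadj_neighbors_cycleGraph {n : ℕ} (hn : 4 ≤ n) (i : Fin n) :
    ∃ j l, j ≠ l ∧ (SimpleGraph.cycleGraph n).Adj i j ∧ (SimpleGraph.cycleGraph n).Adj i l ∧
      ¬ (SimpleGraph.cycleGraph n).Adj j l := by
  obtain ⟨m, rfl⟩ := Nat.exists_eq_add_of_le' hn
  have h_sub : (i + 1) - (i - 1) = 1 + 1 := by abel
  have h_sub' : (i - 1) - (i + 1) = -(1 + 1) := by abel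
  have two_ne_zero' : (1 + 1 : Fin (m + 4)) ≠ 0 := by
    simp [Fin.ext_iff, Fin.val_add, Nat.mod_eq_of_lt]
  have two_ne_one : (1 + 1 : Fin (m + 4)) ≠ 1 := by
    simp
  have three_ne_zero' : (1 + (1 + 1) : Fin (m + 4)) ≠ 0 := by
    simp [Fin.ext_iff, Fin.val_add, Nat.mod_eq_of_lt]
  refine ⟨i + 1, i - 1, fun h => ?_, ?_, ?_, ?_⟩
  · rw [h, sub_self] at h_sub
    exact two_ne_zero' h_sub.symm
  · rw [SimpleGraph.cycleGraph_adj]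
    exact Or.inr (by abel)
  · rw [SimpleGraph.cycleGraph_adj]
    exact Or.inl (by abel)
  · rw [SimpleGraph.cycleGraph_adj, h_sub, h_sub']
    rintro (h | h)
    · exact two_ne_one h
    · exact three_ne_zero' (by nth_rewrite 1 [← h]; abel)

/-- A graph is chordal if its vertices can be ranked so that the neighbours of each vertex
of at least its own rank form a clique. -/
theorem IsChordal.of_rank {G : SimpleGraph V} (r : V → ℕ)
    (h : ∀ u a b, G.Adj u a → G.Adj u b → r u ≤ r a → r u ≤ r b → a ≠ b → G.Adj a b) :
    IsChordal G := by
  rintro n hn ⟨f, hf⟩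
  have : Nonempty (Fin n) := ⟨⟨0, by omega⟩⟩
  obtain ⟨i, hi⟩ := Finite.exists_min fun i => r (f i)
  obtain ⟨j, l, hjl, hij, hil, hnot⟩ := exists_nonadj_neighbors_cycleGraph hn i
  exact hnot <| (hf j l).2 <|
    h _ _ _ ((hf i j).1 hij) ((hf i l).1 hil) (hi j) (hi l) (f.injective.ne hjl)

/-- The gadget graph is chordal. -/
theorem stmt14 {X : Type*} [Fintype X] (C : Finset (Sym2 X)) (k : ℕ) (hk : 1 ≤ k)
    (hC : ∀ e ∈ C, ¬ e.IsDiag) :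
    IsChordal (gadget X C k) := by
  refine IsChordal.of_rank (Sum.elim (fun _ => 0) (Sum.elim (fun _ => 1) fun _ => 2)) ?_
  rintro (x | ⟨x, s⟩ | c) (y | ⟨y, t⟩ | d) (z | ⟨z, w⟩ | e) hua hub hra hrb hab <;>
    simp_all [gadget, SimpleGraph.fromRel_adj] <;> grind
end

section
/- Let X be a finite set of variables, C a nonempty finite set of clauses each consisting of two distinct variables from X, and k ≥ 1 an integer. Let G be the graph with vertex set {v_x : x ∈ X} ∪ (⋃_{x∈X} K_x) ∪ {v_c : c ∈ C}, where the sets K_x have size 2k+1 each and all listed sets are pairwise disjoint, and with edges so that: each K_x is a clique and v_x is adjacent to all of K_x; the set K_C = {v_c : c ∈ C} is a clique; and for each clause c = (x ∨ y) ∈ C, the vertex v_c is adjacent to all of K_x and all of K_y. Then α(G) = |X| + 1. -/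
variable {V : Type*}

/-- A set of vertices is independent: its vertices are pairwise nonadjacent. -/
def SimpleGraph.IsIndepSet' (G : SimpleGraph V) (s : Set V) : Prop :=
  s.Pairwise fun u v => ¬ G.Adj u v

/-- The independence number: the maximum size of an independent set. -/
noncomputable def indNum (G : SimpleGraph V) : ℕ :=
  sSup {n | ∃ s : Finset V, G.IsIndepSet' ↑s ∧ s.card = n}

/-- The cover of the gadget graph by the cliques `{v_x} ∪ K_x`, labelled by `some x`, and `K_C`,
labelled by `none`. -/
def gadgetCliqueLabel {X : Type*} {C : Finset (Sym2 X)} {k : ℕ} :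
    X ⊕ (X × Fin (2 * k + 1)) ⊕ {e : Sym2 X // e ∈ C} → Option X
  | Sum.inl x => some x
  | Sum.inr (Sum.inl (x, _)) => some x
  | Sum.inr (Sum.inr _) => none

theorem gadget_adj_of_cliqueLabel_eq {X : Type*} {C : Finset (Sym2 X)} {k : ℕ}
    {u v : X ⊕ (X × Fin (2 * k + 1)) ⊕ {e : Sym2 X // e ∈ C}} (huv : u ≠ v)
    (h : gadgetCliqueLabel u = gadgetCliqueLabel v) : (gadget X C k).Adj u v := by
  refine (SimpleGraph.fromRel_adj _ _ _).2 ⟨huv, ?_⟩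
  rcases u with x | ⟨x, i⟩ | c <;> rcases v with y | ⟨y, j⟩ | d <;>
    simp_all [gadgetCliqueLabel]

theorem card_le_of_isIndepSet'_gadget {X : Type*} [Fintype X] {C : Finset (Sym2 X)} {k : ℕ}
    {s : Finset (X ⊕ (X × Fin (2 * k + 1)) ⊕ {e : Sym2 X // e ∈ C})}
    (hs : (gadget X C k).IsIndepSet' ↑s) : s.card ≤ Fintype.card X + 1 := by
  have hinj : Set.InjOn (gadgetCliqueLabel (C := C) (k := k)) ↑s := by
    intro u hu v hv h
    by_contra huv
    exact hs hu hv huv (gadget_adj_of_cliqueLabel_eq huv h)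
  simpa using Finset.card_le_card_of_injOn _ (t := Finset.univ)
    (fun _ _ => Finset.mem_coe.2 (Finset.mem_univ _)) hinj

theorem exists_isIndepSet'_gadget {X : Type*} [Fintype X] {C : Finset (Sym2 X)} (k : ℕ)
    (hC : C.Nonempty) :
    ∃ s : Finset (X ⊕ (X × Fin (2 * k + 1)) ⊕ {e : Sym2 X // e ∈ C}),
      (gadget X C k).IsIndepSet' ↑s ∧ s.card = Fintype.card X + 1 := by
  obtain ⟨c, hc⟩ := hC
  refine ⟨Finset.univ.disjSum {Sum.inr ⟨c, hc⟩}, ?_, by simp⟩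
  intro u hu v hv huv hadj
  obtain ⟨-, h⟩ := (SimpleGraph.fromRel_adj _ _ _).1 hadj
  rcases u with x | ⟨x, i⟩ | d <;> rcases v with y | ⟨y, j⟩ | e <;> simp_all

/-- If the clause set is nonempty and each clause consists of two
distinct variables, then the independence number of the gadget graph is `|X| + 1`. -/
theorem stmt15 {X : Type*} [Fintype X] (C : Finset (Sym2 X)) (k : ℕ) (hk : 1 ≤ k)
    (hC : ∀ e ∈ C, ¬ e.IsDiag) (hCne : C.Nonempty) :
    indNum (gadget X C k) = Fintype.card X + 1 := by
  refine IsGreatest.csSup_eq ⟨exists_isIndepSet'_gadget k hCne, ?_⟩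
  rintro n ⟨s, hs, rfl⟩
  exact card_le_of_isIndepSet'_gadget hs
end
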